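/- arXiv:1805.07861 — 5 statements merged into one kernel-verified Lean document; each statement's English description precedes it below -/
import Mathlib

section
/- Let K ≥ 1 and M_r ≥ 1, set n = K·M_r, and let H ∈ C^{n × n} be invertible with row-block partition H = [H¹; …; H^K], each H^k ∈ C^{M_r × n}. For each k let V_ini^k ∈ C^{M_r × M_r} be unitary, and define W_k = (HᴴH)⁻¹ (H^k)ᴴ V_ini^k and W = [W_1, …, W_K] ∈ C^{n × n}. Let σ² ≥ 0 and γ² > 0, set μ = γ²/(γ² + σ²), and define V_kᴴ = W_kᴴ (H^k)ᴴ ( H^k W Wᴴ (H^k)ᴴ + (σ²/γ²)·I_{M_r} )⁻¹. Then V_kᴴ = μ · (V_ini^k)ᴴ. -/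
open Matrix

/-- With `H ∈ ℂ^{n×n}` (`n = K·Mr`) invertible, row-block partition
`H = [H¹; …; H^K]`, unitary initial combiners `Vini^k`, digital precoders
`W_k = (HᴴH)⁻¹ (H^k)ᴴ Vini^k`, `W = [W_1, …, W_K]`, and the min-SMSE digital combiner
`V_kᴴ = W_kᴴ (H^k)ᴴ (H^k W Wᴴ (H^k)ᴴ + (σ²/γ²)·I)⁻¹`, one has
`V_kᴴ = μ · (Vini^k)ᴴ` where `μ = γ²/(γ²+σ²)`. -/
theorem combiner_equals_mu_Vini
    (K Mr : ℕ) (hK : 1 ≤ K) (hMr : 1 ≤ Mr)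
    (H : Matrix (Fin K × Fin Mr) (Fin K × Fin Mr) ℂ) (hH : IsUnit H)
    (Hb : Fin K → Matrix (Fin Mr) (Fin K × Fin Mr) ℂ)
    (hHb : ∀ (k : Fin K) (r : Fin Mr) (c : Fin K × Fin Mr), Hb k r c = H (k, r) c)
    (Vini : Fin K → Matrix (Fin Mr) (Fin Mr) ℂ)
    (hVini : ∀ k, (Vini k)ᴴ * Vini k = 1 ∧ Vini k * (Vini k)ᴴ = 1)
    (Wb : Fin K → Matrix (Fin K × Fin Mr) (Fin Mr) ℂ)
    (hWb : ∀ k, Wb k = (Hᴴ * H)⁻¹ * (Hb k)ᴴ * Vini k)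
    (W : Matrix (Fin K × Fin Mr) (Fin K × Fin Mr) ℂ)
    (hW : ∀ (r c : Fin K × Fin Mr), W r c = Wb c.1 r c.2)
    (σsq γsq : ℝ) (hσ : 0 ≤ σsq) (hγ : 0 < γsq)
    (μ : ℝ) (hμ : μ = γsq / (γsq + σsq))
    (VH : Fin K → Matrix (Fin Mr) (Fin Mr) ℂ)
    (hVH : ∀ k, VH k = (Wb k)ᴴ * (Hb k)ᴴ *
      (Hb k * W * Wᴴ * (Hb k)ᴴ + ((σsq / γsq : ℝ) : ℂ) • (1 : Matrix (Fin Mr) (Fin Mr) ℂ))⁻¹)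
    (k : Fin K) :
    VH k = (μ : ℂ) • (Vini k)ᴴ := by
  have hdet : IsUnit H.det := (Matrix.isUnit_iff_isUnit_det H).mp hH
  have hdet' : IsUnit Hᴴ.det := by
    rw [Matrix.det_conjTranspose]; exact hdet.star
  have hG : H * (Hᴴ * H)⁻¹ * Hᴴ = 1 := by
    rw [Matrix.mul_inv_rev, ← Matrix.mul_assoc, Matrix.mul_nonsing_inv _ hdet, Matrix.one_mul,
      Matrix.nonsing_inv_mul _ hdet']
  have hE : ∀ j, Hb j = (1 : Matrix (Fin K × Fin Mr) (Fin K × Fin Mr) ℂ).submatrix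
      (fun r : Fin Mr => (j, r)) id * H := by
    intro j
    ext r c
    simp [hHb, Matrix.mul_apply, Matrix.one_apply]
  have hHW : ∀ j l, Hb j * Wb l = if j = l then Vini l else 0 := by
    intro j l
    have h1 : Hb j * (Hᴴ * H)⁻¹ * (Hb l)ᴴ = if j = l then 1 else 0 := by
      rw [hE j, hE l, Matrix.conjTranspose_mul]
      have : ∀ (A : Matrix (Fin Mr) (Fin K × Fin Mr) ℂ) (B : Matrix (Fin K × Fin Mr) (Fin Mr) ℂ),
          A * H * (Hᴴ * H)⁻¹ * (Hᴴ * B) = A * B := by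
        intro A B
        calc A * H * (Hᴴ * H)⁻¹ * (Hᴴ * B) = A * (H * (Hᴴ * H)⁻¹ * Hᴴ) * B := by
              simp only [Matrix.mul_assoc]
          _ = A * B := by rw [hG, Matrix.mul_one]
      rw [this]
      ext r s
      by_cases h : j = l
      · subst h
        simp [Matrix.mul_apply, Matrix.one_apply, eq_comm]
      · simp [Matrix.mul_apply, Matrix.one_apply, h, Ne.symm h, eq_comm]
    rw [hWb, ← Matrix.mul_assoc, ← Matrix.mul_assoc, h1]
    split_ifs <;> simp
  have hHWe : ∀ (r : Fin Mr) (c : Fin K × Fin Mr),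
      (Hb k * W) r c = if k = c.1 then Vini k r c.2 else 0 := by
    intro r c
    have h2 : (Hb k * W) r c = (Hb k * Wb c.1) r c.2 := by
      simp [Matrix.mul_apply, hW]
    rw [h2, hHW]
    split_ifs with h
    · rw [h]
    · rfl
  have hone : Hb k * W * Wᴴ * (Hb k)ᴴ = 1 := by
    rw [Matrix.mul_assoc, ← Matrix.conjTranspose_mul, ← (hVini k).2]
    ext r s
    rw [Matrix.mul_apply, Matrix.mul_apply, Fintype.sum_prod_type, Finset.sum_eq_single k]
    · simp [Matrix.conjTranspose_apply, hHWe]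
    · intro b _ hb
      simp [hHWe, Ne.symm hb]
    · simp
  have hsc : (1 : Matrix (Fin Mr) (Fin Mr) ℂ) + ((σsq / γsq : ℝ) : ℂ) • 1
      = ((1 + σsq / γsq : ℝ) : ℂ) • 1 := by
    push_cast
    rw [add_smul, one_smul]
  have hμ' : μ * (1 + σsq / γsq) = 1 := by
    have : γsq + σsq ≠ 0 := by positivity
    rw [hμ]; field_simp
  have hinv : (((1 + σsq / γsq : ℝ) : ℂ) • (1 : Matrix (Fin Mr) (Fin Mr) ℂ))⁻¹
      = (μ : ℂ) • 1 := by
    apply Matrix.inv_eq_left_inv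
    rw [Matrix.smul_mul, Matrix.one_mul, smul_smul, ← Complex.ofReal_mul, hμ',
      Complex.ofReal_one, one_smul]
  rw [hVH, hone, hsc, hinv, ← Matrix.conjTranspose_mul, hHW, if_pos rfl, Matrix.mul_smul,
    Matrix.mul_one]
end

section
/- Let K ≥ 1 and M_r ≥ 1, set n = K·M_r, and let H ∈ C^{n × n} be invertible with row-block partition H = [H¹; …; H^K], each H^k ∈ C^{M_r × n}. For each k let V_ini^k ∈ C^{M_r × M_r} be unitary, define W_k = (HᴴH)⁻¹ (H^k)ᴴ V_ini^k, W = [W_1, …, W_K], and for σ² ≥ 0, γ² > 0 define V_kᴴ = W_kᴴ (H^k)ᴴ ( H^k W Wᴴ (H^k)ᴴ + (σ²/γ²)·I_{M_r} )⁻¹ and μ = γ²/(γ² + σ²). Then for every k, V_kᴴ H^k W_k = μ · I_{M_r}. -/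
open Matrix

/-- In the setting of the min-SMSE digital design (see Statement 5),
for every user `k`, `V_kᴴ H^k W_k = μ · I_{Mr}` with `μ = γ²/(γ²+σ²)`. -/
theorem combiner_channel_precoder_identity
    (K Mr : ℕ) (hK : 1 ≤ K) (hMr : 1 ≤ Mr)
    (H : Matrix (Fin K × Fin Mr) (Fin K × Fin Mr) ℂ) (hH : IsUnit H)
    (Hb : Fin K → Matrix (Fin Mr) (Fin K × Fin Mr) ℂ)
    (hHb : ∀ (k : Fin K) (r : Fin Mr) (c : Fin K × Fin Mr), Hb k r c = H (k, r) c)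
    (Vini : Fin K → Matrix (Fin Mr) (Fin Mr) ℂ)
    (hVini : ∀ k, (Vini k)ᴴ * Vini k = 1 ∧ Vini k * (Vini k)ᴴ = 1)
    (Wb : Fin K → Matrix (Fin K × Fin Mr) (Fin Mr) ℂ)
    (hWb : ∀ k, Wb k = (Hᴴ * H)⁻¹ * (Hb k)ᴴ * Vini k)
    (W : Matrix (Fin K × Fin Mr) (Fin K × Fin Mr) ℂ)
    (hW : ∀ (r c : Fin K × Fin Mr), W r c = Wb c.1 r c.2)
    (σsq γsq : ℝ) (hσ : 0 ≤ σsq) (hγ : 0 < γsq)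
    (μ : ℝ) (hμ : μ = γsq / (γsq + σsq))
    (VH : Fin K → Matrix (Fin Mr) (Fin Mr) ℂ)
    (hVH : ∀ k, VH k = (Wb k)ᴴ * (Hb k)ᴴ *
      (Hb k * W * Wᴴ * (Hb k)ᴴ + ((σsq / γsq : ℝ) : ℂ) • (1 : Matrix (Fin Mr) (Fin Mr) ℂ))⁻¹)
    (k : Fin K) :
    VH k * Hb k * Wb k = (μ : ℂ) • (1 : Matrix (Fin Mr) (Fin Mr) ℂ) := by
  have hdet : IsUnit H.det := (Matrix.isUnit_iff_isUnit_det H).1 hH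
  have hdet' : IsUnit (Hᴴ).det := by
    rw [Matrix.det_conjTranspose]; exact hdet.star
  have hP : H * (Hᴴ * H)⁻¹ * Hᴴ = 1 := by
    rw [Matrix.mul_inv_rev, ← Matrix.mul_assoc, Matrix.mul_nonsing_inv _ hdet, Matrix.one_mul,
      Matrix.nonsing_inv_mul _ hdet']
  have hsub : ∀ j, Hb j = H.submatrix (fun r => (j, r)) id := by
    intro j; ext r c; exact hHb j r c
  have hblk : ∀ i j, Hb i * (Hᴴ * H)⁻¹ * (Hb j)ᴴ
      = (1 : Matrix (Fin K × Fin Mr) (Fin K × Fin Mr) ℂ).submatrix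
          (fun r => (i, r)) (fun r => (j, r)) := by
    intro i j
    rw [← hP, hsub i, hsub j]
    rfl
  have hHW : ∀ j, Hb k * Wb j = if j = k then Vini k else 0 := by
    intro j
    rw [hWb, ← Matrix.mul_assoc, ← Matrix.mul_assoc, hblk]
    split_ifs with h
    · subst h
      have : (1 : Matrix (Fin K × Fin Mr) (Fin K × Fin Mr) ℂ).submatrix
          (fun r => (j, r)) (fun r => (j, r)) = (1 : Matrix (Fin Mr) (Fin Mr) ℂ) :=
        Matrix.submatrix_one _ (fun a b hab => by simpa using hab)
      rw [this, Matrix.one_mul]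
    · have : (1 : Matrix (Fin K × Fin Mr) (Fin K × Fin Mr) ℂ).submatrix
          (fun r => (k, r)) (fun r => (j, r)) = (0 : Matrix (Fin Mr) (Fin Mr) ℂ) := by
        ext a b
        simp [Matrix.one_apply, Ne.symm h]
      rw [this, Matrix.zero_mul]
  have hent : ∀ r c, (Hb k * W) r c = if c.1 = k then Vini k r c.2 else 0 := by
    intro r c
    have h1 : (Hb k * W) r c = (Hb k * Wb c.1) r c.2 := by
      simp [Matrix.mul_apply, hW]
    rw [h1, hHW]
    split_ifs <;> rfl
  have hG : Hb k * W * Wᴴ * (Hb k)ᴴ = 1 := by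
    rw [Matrix.mul_assoc (Hb k * W), ← Matrix.conjTranspose_mul, ← (hVini k).2]
    ext a b
    rw [Matrix.mul_apply, Matrix.mul_apply, Fintype.sum_prod_type]
    simp only [Matrix.conjTranspose_apply, hent]
    rw [Finset.sum_eq_single k]
    · simp
    · intro j _ hj; simp [hj]
    · simp
  have hkk : Hb k * Wb k = Vini k := by simpa using hHW k
  have hpos : γsq + σsq ≠ 0 := by positivity
  have hmu : μ * (1 + σsq / γsq) = 1 := by
    rw [hμ]; field_simp
  have hmuC : (μ : ℂ) * (1 + ((σsq / γsq : ℝ) : ℂ)) = 1 := by exact_mod_cast hmu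
  have hinv : (1 + ((σsq / γsq : ℝ) : ℂ) • (1 : Matrix (Fin Mr) (Fin Mr) ℂ))⁻¹
      = (μ : ℂ) • (1 : Matrix (Fin Mr) (Fin Mr) ℂ) := by
    apply Matrix.inv_eq_left_inv
    rw [Matrix.smul_mul, Matrix.one_mul, smul_add, smul_smul, ← add_smul]
    rw [show (μ : ℂ) + μ * ((σsq / γsq : ℝ) : ℂ) = 1 by rw [← hmuC]; ring, one_smul]
  rw [hVH, hG, hinv, Matrix.mul_assoc, hkk, ← Matrix.conjTranspose_mul, hkk, Matrix.mul_smul,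
    Matrix.mul_one, Matrix.smul_mul, (hVini k).1]
end

section
/- Let K ≥ 1 and M_r ≥ 1, set n = K·M_r, and let H ∈ C^{n × n} be invertible with row-block partition H = [H¹; …; H^K], each H^k ∈ C^{M_r × n}. For each k let V_ini^k ∈ C^{M_r × M_r} be unitary, define W_k = (HᴴH)⁻¹ (H^k)ᴴ V_ini^k, W = [W_1, …, W_K], and for σ² ≥ 0, γ² > 0 define V_mᴴ = W_mᴴ (H^m)ᴴ ( H^m W Wᴴ (H^m)ᴴ + (σ²/γ²)·I_{M_r} )⁻¹. Then for all m ≠ k (1 ≤ m, k ≤ K), V_mᴴ H^m W_k = 0 (the M_r × M_r zero matrix). -/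
open Matrix

/-- In the setting of the min-SMSE digital design (see Statement 5),
for all users `m ≠ k`, `V_mᴴ H^m W_k = 0`: inter-user interference is eliminated exactly. -/
theorem interuser_interference_vanishes
    (K Mr : ℕ) (hK : 1 ≤ K) (hMr : 1 ≤ Mr)
    (H : Matrix (Fin K × Fin Mr) (Fin K × Fin Mr) ℂ) (hH : IsUnit H)
    (Hb : Fin K → Matrix (Fin Mr) (Fin K × Fin Mr) ℂ)
    (hHb : ∀ (k : Fin K) (r : Fin Mr) (c : Fin K × Fin Mr), Hb k r c = H (k, r) c)
    (Vini : Fin K → Matrix (Fin Mr) (Fin Mr) ℂ)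
    (hVini : ∀ k, (Vini k)ᴴ * Vini k = 1 ∧ Vini k * (Vini k)ᴴ = 1)
    (Wb : Fin K → Matrix (Fin K × Fin Mr) (Fin Mr) ℂ)
    (hWb : ∀ k, Wb k = (Hᴴ * H)⁻¹ * (Hb k)ᴴ * Vini k)
    (W : Matrix (Fin K × Fin Mr) (Fin K × Fin Mr) ℂ)
    (hW : ∀ (r c : Fin K × Fin Mr), W r c = Wb c.1 r c.2)
    (σsq γsq : ℝ) (hσ : 0 ≤ σsq) (hγ : 0 < γsq)
    (μ : ℝ) (hμ : μ = γsq / (γsq + σsq))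
    (VH : Fin K → Matrix (Fin Mr) (Fin Mr) ℂ)
    (hVH : ∀ k, VH k = (Wb k)ᴴ * (Hb k)ᴴ *
      (Hb k * W * Wᴴ * (Hb k)ᴴ + ((σsq / γsq : ℝ) : ℂ) • (1 : Matrix (Fin Mr) (Fin Mr) ℂ))⁻¹)
    (m k : Fin K) (hmk : m ≠ k) :
    VH m * Hb m * Wb k = (0 : Matrix (Fin Mr) (Fin Mr) ℂ) := by
  have hdet : IsUnit H.det := (Matrix.isUnit_iff_isUnit_det H).mp hH
  have hdet' : IsUnit Hᴴ.det := by
    rw [Matrix.det_conjTranspose]; exact hdet.star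
  have h1 : H * (Hᴴ * H)⁻¹ * Hᴴ = 1 := by
    rw [Matrix.mul_inv_rev, ← Matrix.mul_assoc, Matrix.mul_nonsing_inv _ hdet,
      Matrix.one_mul, Matrix.nonsing_inv_mul _ hdet']
  have hb : ∀ j, Hb j = H.submatrix (fun r => (j, r)) id := by
    intro j; ext r c; simp [hHb]
  have h2 : Hb m * (Hᴴ * H)⁻¹ * (Hb k)ᴴ = 0 := by
    have h3 : Hb m * (Hᴴ * H)⁻¹ * (Hb k)ᴴ
        = (H * (Hᴴ * H)⁻¹ * Hᴴ).submatrix (fun r => (m, r)) (fun r => (k, r)) := by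
      rw [hb, hb]; rfl
    rw [h3, h1]
    ext r c
    simp [Matrix.one_apply, hmk]
  have h4 : Hb m * Wb k = 0 := by
    rw [hWb, ← Matrix.mul_assoc, ← Matrix.mul_assoc, h2, Matrix.zero_mul]
  rw [Matrix.mul_assoc, h4, Matrix.mul_zero]
end

section
/- Let K ≥ 1 and M_r ≥ 1, set n = K·M_r, and let H ∈ C^{n × n} be invertible with row-block partition H = [H¹; …; H^K], each H^k ∈ C^{M_r × n}. For each k let V_ini^k ∈ C^{M_r × M_r} be unitary, define W_k = (HᴴH)⁻¹ (H^k)ᴴ V_ini^k, W = [W_1, …, W_K], and for σ² ≥ 0, γ² > 0 define V_kᴴ = W_kᴴ (H^k)ᴴ ( H^k W Wᴴ (H^k)ᴴ + (σ²/γ²)·I_{M_r} )⁻¹ and μ = γ²/(γ² + σ²). Let V ∈ C^{n × n} be the block-diagonal matrix V = diag(V_1, …, V_K). Then Vᴴ H W = μ · I_n. In particular, the product Vᴴ H W is the same for every choice of the unitary matrices V_ini^1, …, V_ini^K. -/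
open Matrix

/-- In the setting of the min-SMSE digital design (see Statement 5),
with `V = diag(V_1, …, V_K)` the block-diagonal stacked digital combiner
(`V_k = (V_kᴴ)ᴴ`), one has `Vᴴ H W = μ · I_n`; in particular `Vᴴ H W` does not depend on
the choice of the unitary initial combiners `Vini^k`. -/
theorem stacked_combiner_channel_precoder_identity
    (K Mr : ℕ) (hK : 1 ≤ K) (hMr : 1 ≤ Mr)
    (H : Matrix (Fin K × Fin Mr) (Fin K × Fin Mr) ℂ) (hH : IsUnit H)
    (Hb : Fin K → Matrix (Fin Mr) (Fin K × Fin Mr) ℂ)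
    (hHb : ∀ (k : Fin K) (r : Fin Mr) (c : Fin K × Fin Mr), Hb k r c = H (k, r) c)
    (Vini : Fin K → Matrix (Fin Mr) (Fin Mr) ℂ)
    (hVini : ∀ k, (Vini k)ᴴ * Vini k = 1 ∧ Vini k * (Vini k)ᴴ = 1)
    (Wb : Fin K → Matrix (Fin K × Fin Mr) (Fin Mr) ℂ)
    (hWb : ∀ k, Wb k = (Hᴴ * H)⁻¹ * (Hb k)ᴴ * Vini k)
    (W : Matrix (Fin K × Fin Mr) (Fin K × Fin Mr) ℂ)
    (hW : ∀ (r c : Fin K × Fin Mr), W r c = Wb c.1 r c.2)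
    (σsq γsq : ℝ) (hσ : 0 ≤ σsq) (hγ : 0 < γsq)
    (μ : ℝ) (hμ : μ = γsq / (γsq + σsq))
    (VH : Fin K → Matrix (Fin Mr) (Fin Mr) ℂ)
    (hVH : ∀ k, VH k = (Wb k)ᴴ * (Hb k)ᴴ *
      (Hb k * W * Wᴴ * (Hb k)ᴴ + ((σsq / γsq : ℝ) : ℂ) • (1 : Matrix (Fin Mr) (Fin Mr) ℂ))⁻¹)
    (V : Matrix (Fin K × Fin Mr) (Fin K × Fin Mr) ℂ)
    (hV : ∀ (r c : Fin K × Fin Mr),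
      V r c = if r.1 = c.1 then ((VH r.1)ᴴ) r.2 c.2 else 0) :
    Vᴴ * H * W = (μ : ℂ) • (1 : Matrix (Fin K × Fin Mr) (Fin K × Fin Mr) ℂ) := by
  obtain ⟨B, hB⟩ : ∃ B : Matrix (Fin K × Fin Mr) (Fin K × Fin Mr) ℂ,
      ∀ r c, B r c = if r.1 = c.1 then Vini r.1 r.2 c.2 else 0 := ⟨fun r c => _, fun r c => rfl⟩
  have hBB : Bᴴ * B = 1 := by
    ext ⟨i, a⟩ ⟨j, b⟩
    have h := congrFun (congrFun (hVini i).1 a) b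
    simp only [Matrix.mul_apply, Matrix.conjTranspose_apply, Matrix.one_apply] at h
    simp only [Matrix.mul_apply, Matrix.conjTranspose_apply, hB, Fintype.sum_prod_type,
      Matrix.one_apply, Prod.mk.injEq]
    rw [Finset.sum_eq_single i (fun x _ hx => by simp [hx]) (by simp)]
    by_cases hij : i = j
    · subst hij
      simpa using h
    · simp [hij]
  have hBB' : B * Bᴴ = 1 := mul_eq_one_comm.mp hBB
  have hHb' : ∀ k, Hb k = H.submatrix (fun r => (k, r)) id := by
    intro k; ext r c; simp [hHb]
  have hWb' : ∀ k, Wb k = W.submatrix id (fun r => (k, r)) := by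
    intro k; ext r c; simp [hW]
  have hWB : W = (Hᴴ * H)⁻¹ * Hᴴ * B := by
    ext r ⟨j, b⟩
    rw [hW, hWb]
    simp only [Matrix.mul_apply (M := (Hᴴ * H)⁻¹ * Hᴴ), hB, Fintype.sum_prod_type]
    rw [Finset.sum_eq_single j (fun x _ hx => by simp [hx]) (by simp)]
    simp [Matrix.mul_apply (N := Vini j), Matrix.mul_apply (M := (Hᴴ * H)⁻¹), hHb]
  have hdet : IsUnit H.det := (Matrix.isUnit_iff_isUnit_det H).mp hH
  have hdet' : IsUnit (Hᴴ).det := by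
    rw [Matrix.det_conjTranspose]; exact hdet.star
  have hHW : H * W = B := by
    rw [hWB, Matrix.mul_inv_rev, Matrix.mul_assoc H⁻¹, Matrix.nonsing_inv_mul _ hdet',
      Matrix.mul_one, ← Matrix.mul_assoc, Matrix.mul_nonsing_inv _ hdet, Matrix.one_mul]
  have hHkW : ∀ k, Hb k * W = B.submatrix (fun r => (k, r)) id := by
    intro k; rw [← hHW, hHb']; rfl
  have hgram : ∀ k, Hb k * W * Wᴴ * (Hb k)ᴴ = 1 := by
    intro k
    rw [Matrix.mul_assoc, ← Matrix.conjTranspose_mul, hHkW]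
    have : B.submatrix (fun r : Fin Mr => (k, r)) id * (B.submatrix (fun r => (k, r)) id)ᴴ
        = (B * Bᴴ).submatrix (fun r => (k, r)) (fun r => (k, r)) := rfl
    rw [this, hBB']
    exact Matrix.submatrix_one _ (fun a b h => by simpa using h)
  have hHkWk : ∀ k, Hb k * Wb k = Vini k := by
    intro k
    have : Hb k * Wb k = (H * W).submatrix (fun r => (k, r)) (fun r => (k, r)) := by
      rw [hHb', hWb']; rfl
    rw [this, hHW]; ext a b; simp [hB]
  have hs : γsq + σsq ≠ 0 := by positivity
  have hVH' : ∀ k, VH k = (μ : ℂ) • (Vini k)ᴴ := by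
    intro k
    have hinv : ((1 : Matrix (Fin Mr) (Fin Mr) ℂ) + ((σsq / γsq : ℝ) : ℂ) • 1)⁻¹
        = (μ : ℂ) • 1 := by
      apply Matrix.inv_eq_left_inv
      have h1 : (μ : ℂ) * (1 + ((σsq / γsq : ℝ) : ℂ)) = 1 := by
        have : μ * (1 + σsq / γsq) = 1 := by rw [hμ]; field_simp
        exact_mod_cast this
      rw [smul_mul_assoc, Matrix.one_mul, smul_add, smul_smul, ← add_smul, ← mul_one_add, h1,
        one_smul]
    rw [hVH, hgram, hinv, ← Matrix.conjTranspose_mul, hHkWk, Matrix.mul_smul, Matrix.mul_one]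
  have hVB : Vᴴ = (μ : ℂ) • Bᴴ := by
    ext r c
    simp only [Matrix.conjTranspose_apply, Matrix.smul_apply, hV, hB, hVH']
    split_ifs <;> simp
  rw [hVB, Matrix.mul_assoc, hHW, Matrix.smul_mul, hBB]
end

section
/- Let K ≥ 1 and M_r ≥ 1, set n = K·M_r, and let H ∈ C^{n × n} be invertible with row-block partition H = [H¹; …; H^K], each H^k ∈ C^{M_r × n}. For each k let V_ini^k ∈ C^{M_r × M_r} be unitary, define W_k = (HᴴH)⁻¹ (H^k)ᴴ V_ini^k, W = [W_1, …, W_K], and for σ² ≥ 0, γ² > 0 define V_kᴴ = W_kᴴ (H^k)ᴴ ( H^k W Wᴴ (H^k)ᴴ + (σ²/γ²)·I_{M_r} )⁻¹, V = diag(V_1, …, V_K), and μ = γ²/(γ² + σ²). Then the sum mean-square error ξ = Re[ tr(Vᴴ H W Wᴴ Hᴴ V) − tr(Vᴴ H W) − tr(Wᴴ Hᴴ V) + (σ²/γ²)·tr(Vᴴ V) + n ] satisfies ξ = (μ² − 2μ + 1)·n + (σ²/γ²)·μ²·n, and consequently ξ = n·σ²/(γ² + σ²). -/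
open Matrix

/-- In the setting of the min-SMSE digital design (see Statement 5),
with `V = diag(V_1, …, V_K)` the block-diagonal stacked digital combiner, the sum MSE
`ξ = Re[tr(Vᴴ H W Wᴴ Hᴴ V) − tr(Vᴴ H W) − tr(Wᴴ Hᴴ V) + (σ²/γ²)·tr(Vᴴ V) + n]`
satisfies `ξ = (μ² − 2μ + 1)·n + (σ²/γ²)·μ²·n`, and consequently `ξ = n·σ²/(γ²+σ²)`. -/
theorem SMSE_closed_form
    (K Mr : ℕ) (hK : 1 ≤ K) (hMr : 1 ≤ Mr)
    (H : Matrix (Fin K × Fin Mr) (Fin K × Fin Mr) ℂ) (hH : IsUnit H)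
    (Hb : Fin K → Matrix (Fin Mr) (Fin K × Fin Mr) ℂ)
    (hHb : ∀ (k : Fin K) (r : Fin Mr) (c : Fin K × Fin Mr), Hb k r c = H (k, r) c)
    (Vini : Fin K → Matrix (Fin Mr) (Fin Mr) ℂ)
    (hVini : ∀ k, (Vini k)ᴴ * Vini k = 1 ∧ Vini k * (Vini k)ᴴ = 1)
    (Wb : Fin K → Matrix (Fin K × Fin Mr) (Fin Mr) ℂ)
    (hWb : ∀ k, Wb k = (Hᴴ * H)⁻¹ * (Hb k)ᴴ * Vini k)
    (W : Matrix (Fin K × Fin Mr) (Fin K × Fin Mr) ℂ)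
    (hW : ∀ (r c : Fin K × Fin Mr), W r c = Wb c.1 r c.2)
    (σsq γsq : ℝ) (hσ : 0 ≤ σsq) (hγ : 0 < γsq)
    (μ : ℝ) (hμ : μ = γsq / (γsq + σsq))
    (VH : Fin K → Matrix (Fin Mr) (Fin Mr) ℂ)
    (hVH : ∀ k, VH k = (Wb k)ᴴ * (Hb k)ᴴ *
      (Hb k * W * Wᴴ * (Hb k)ᴴ + ((σsq / γsq : ℝ) : ℂ) • (1 : Matrix (Fin Mr) (Fin Mr) ℂ))⁻¹)
    (V : Matrix (Fin K × Fin Mr) (Fin K × Fin Mr) ℂ)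
    (hV : ∀ (r c : Fin K × Fin Mr),
      V r c = if r.1 = c.1 then ((VH r.1)ᴴ) r.2 c.2 else 0)
    (ξ : ℝ)
    (hξ : ξ = ((Vᴴ * H * W * Wᴴ * Hᴴ * V).trace - (Vᴴ * H * W).trace
      - (Wᴴ * Hᴴ * V).trace + ((σsq / γsq : ℝ) : ℂ) * (Vᴴ * V).trace
      + ((K * Mr : ℕ) : ℂ)).re) :
    ξ = (μ ^ 2 - 2 * μ + 1) * ((K * Mr : ℕ) : ℝ)
        + (σsq / γsq) * μ ^ 2 * ((K * Mr : ℕ) : ℝ) ∧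
      ξ = ((K * Mr : ℕ) : ℝ) * σsq / (γsq + σsq) := by
  have hdet : IsUnit H.det := (Matrix.isUnit_iff_isUnit_det H).1 hH
  have hdet' : IsUnit Hᴴ.det := by
    rw [Matrix.det_conjTranspose]; exact hdet.star
  have hproj : H * (Hᴴ * H)⁻¹ * Hᴴ = 1 := by
    rw [Matrix.mul_inv_rev, ← Matrix.mul_assoc, Matrix.mul_nonsing_inv _ hdet, Matrix.one_mul,
      Matrix.nonsing_inv_mul _ hdet']
  let E : Fin K → Matrix (Fin K × Fin Mr) (Fin Mr) ℂ :=
    fun k => (1 : Matrix (Fin K × Fin Mr) (Fin K × Fin Mr) ℂ).submatrix id (fun r => (k, r))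
  have hHbE : ∀ k, (Hb k)ᴴ = Hᴴ * E k := by
    intro k
    ext i j
    simp [E, Matrix.mul_apply, hHb, Matrix.one_apply]
  have hHbE' : ∀ k, Hb k = (E k)ᴴ * H := by
    intro k
    have := congrArg Matrix.conjTranspose (hHbE k)
    simpa using this
  have hHWb : ∀ k, H * Wb k = E k * Vini k := by
    intro k
    rw [hWb, hHbE]
    calc H * ((Hᴴ * H)⁻¹ * (Hᴴ * E k) * Vini k)
        = (H * (Hᴴ * H)⁻¹ * Hᴴ) * (E k * Vini k) := by simp only [Matrix.mul_assoc]
      _ = _ := by rw [hproj, Matrix.one_mul]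
  have hEE : ∀ k, (E k)ᴴ * E k = 1 := by
    intro k
    ext i j
    simp [E, Matrix.mul_apply, Matrix.one_apply]
  have hB : ∀ r c, (H * W) r c = if r.1 = c.1 then Vini r.1 r.2 c.2 else 0 := by
    intro r c
    have h1 : (H * W) r c = (H * Wb c.1) r c.2 := by
      simp [Matrix.mul_apply, hW]
    rw [h1, hHWb]
    obtain ⟨a, b⟩ := r
    obtain ⟨d, e⟩ := c
    by_cases h : a = d
    · subst h
      simp [E, Matrix.mul_apply, Matrix.one_apply]
    · simp [E, Matrix.mul_apply, Matrix.one_apply, h]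
  have hBB : (H * W)ᴴ * (H * W) = 1 := by
    ext i j
    obtain ⟨a, b⟩ := i
    obtain ⟨d, e⟩ := j
    rw [Matrix.mul_apply, Fintype.sum_prod_type]
    simp only [Matrix.conjTranspose_apply, hB]
    by_cases h : a = d
    · subst h
      have := congrFun (congrFun (hVini a).1 b) e
      rw [Matrix.mul_apply] at this
      simp only [Matrix.conjTranspose_apply] at this
      rw [Finset.sum_eq_single a]
      · simpa [Matrix.one_apply] using this
      · intro x _ hx
        simp [hx]
      · simp
    · have hne : ((a, b) : Fin K × Fin Mr) ≠ (d, e) := fun hh => h (congrArg Prod.fst hh)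
      rw [Matrix.one_apply_ne hne]
      refine Finset.sum_eq_zero fun x _ => Finset.sum_eq_zero fun y _ => ?_
      by_cases hx : x = a
      · subst hx
        simp [h]
      · simp [hx]
  have hBB' : (H * W) * (H * W)ᴴ = 1 := mul_eq_one_comm.1 hBB
  have hpos : 0 < γsq + σsq := by linarith
  have hμc : μ * (1 + σsq / γsq) = 1 := by
    rw [hμ]; field_simp
  have hVHk : ∀ k, VH k = (μ : ℂ) • (Vini k)ᴴ := by
    intro k
    have h1 : Hb k * W * Wᴴ * (Hb k)ᴴ = 1 := by
      rw [hHbE, hHbE' k]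
      calc (E k)ᴴ * H * W * Wᴴ * (Hᴴ * E k) = (E k)ᴴ * ((H * W) * (H * W)ᴴ) * E k := by
            simp only [Matrix.mul_assoc, Matrix.conjTranspose_mul]
        _ = 1 := by rw [hBB', Matrix.mul_one, hEE]
    have h2 : (Wb k)ᴴ * (Hb k)ᴴ = (Vini k)ᴴ := by
      rw [hHbE, ← Matrix.mul_assoc, ← Matrix.conjTranspose_mul, hHWb, Matrix.conjTranspose_mul,
        Matrix.mul_assoc, hEE, Matrix.mul_one]
    have h3 : ((1 : Matrix (Fin Mr) (Fin Mr) ℂ) +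
        ((σsq / γsq : ℝ) : ℂ) • (1 : Matrix (Fin Mr) (Fin Mr) ℂ))⁻¹ = (μ : ℂ) • 1 := by
      apply Matrix.inv_eq_left_inv
      have hc : (μ : ℂ) * (1 + ((σsq / γsq : ℝ) : ℂ)) = 1 := by exact_mod_cast hμc
      rw [Matrix.smul_mul, Matrix.one_mul, smul_add, smul_smul, ← add_smul]
      rw [mul_add, mul_one] at hc
      rw [hc, one_smul]
    rw [hVH, h1, h2, h3, Matrix.mul_smul, Matrix.mul_one]
  have hVB : V = (μ : ℂ) • (H * W) := by
    ext r c
    rw [hV, Matrix.smul_apply, hB, hVHk]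
    by_cases h : r.1 = c.1
    · simp [h]
    · simp [h]
  have hVs : Vᴴ = (μ : ℂ) • (H * W)ᴴ := by
    rw [hVB, Matrix.conjTranspose_smul]; simp
  have t1 : Vᴴ * H * W = (μ : ℂ) • 1 := by
    rw [Matrix.mul_assoc, hVs, Matrix.smul_mul, hBB]
  have t2 : Wᴴ * Hᴴ * V = (μ : ℂ) • 1 := by
    rw [← Matrix.conjTranspose_mul, hVB, Matrix.mul_smul, hBB]
  have t3 : Vᴴ * V = ((μ : ℂ) * μ) • 1 := by
    rw [hVs, hVB, Matrix.smul_mul, Matrix.mul_smul, hBB, smul_smul]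
  have t4 : Vᴴ * H * W * Wᴴ * Hᴴ * V = ((μ : ℂ) * μ) • 1 := by
    rw [t1, Matrix.mul_assoc, Matrix.mul_assoc, ← Matrix.mul_assoc Wᴴ, t2, Matrix.smul_mul,
      Matrix.one_mul, smul_smul]
  have hmain : ξ = (μ ^ 2 - 2 * μ + 1) * ((K * Mr : ℕ) : ℝ)
        + (σsq / γsq) * μ ^ 2 * ((K * Mr : ℕ) : ℝ) := by
    rw [hξ, t4, t1, t2, t3]
    simp only [Matrix.trace_smul, Matrix.trace_one, Fintype.card_prod, Fintype.card_fin,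
      smul_eq_mul]
    rw [← Complex.ofReal_re ((μ ^ 2 - 2 * μ + 1) * ((K * Mr : ℕ) : ℝ)
        + (σsq / γsq) * μ ^ 2 * ((K * Mr : ℕ) : ℝ))]
    congr 1
    push_cast
    ring
  refine ⟨hmain, ?_⟩
  rw [hmain, hμ]
  field_simp
  ring
end
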